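/- Let M be a countable conical refinement monoid. Then there exists a dimension monoid Δ (an inductive limit of a sequence of simplicial monoids (ℤ₊)^{r_j} along monoid homomorphisms) such that the set of order-ideals of Δ, partially ordered by inclusion, is order-isomorphic to the set of order-ideals of M, partially ordered by inclusion. -/

import Mathlib

/-- The algebraic preorder on an additive commutative monoid. -/
def AlgLE {M : Type*} [AddCommMonoid M] (x y : M) : Prop := ∃ z : M, x + z = y

/-- `x ∝ y` : `x ≤ n • y` for some natural number `n ≥ 1`. -/
def Propto {M : Type*} [AddCommMonoid M] (x y : M) : Prop :=
  ∃ n : ℕ, 1 ≤ n ∧ AlgLE x (n • y)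

/-- A refinement monoid. -/
def IsRefinement (M : Type*) [AddCommMonoid M] : Prop :=
  ∀ x₁ x₂ y₁ y₂ : M, x₁ + x₂ = y₁ + y₂ →
    ∃ z₁₁ z₁₂ z₂₁ z₂₂ : M,
      x₁ = z₁₁ + z₁₂ ∧ x₂ = z₂₁ + z₂₂ ∧ y₁ = z₁₁ + z₂₁ ∧ y₂ = z₁₂ + z₂₂

/-- A conical monoid: `x + y = 0` implies `x = y = 0`. -/
def IsConical (M : Type*) [AddCommMonoid M] : Prop :=
  ∀ x y : M, x + y = 0 → x = 0 ∧ y = 0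

/-- An order-ideal of an additive commutative monoid: a submonoid `I`
such that `x + y ∈ I ↔ x ∈ I ∧ y ∈ I`. -/
def IsOrderIdeal {M : Type*} [AddCommMonoid M] (I : Set M) : Prop :=
  (0 : M) ∈ I ∧ ∀ x y : M, x + y ∈ I ↔ x ∈ I ∧ y ∈ I

/-- The composite `β_{j+k-1} ∘ ⋯ ∘ β_j` of the connecting maps. -/
def iterComp (r : ℕ → ℕ) (β : ∀ j : ℕ, (Fin (r j) → ℕ) →+ (Fin (r (j + 1)) → ℕ))
    (j : ℕ) : ∀ k : ℕ, (Fin (r j) → ℕ) →+ (Fin (r (j + k)) → ℕ)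
  | 0 => AddMonoidHom.id _
  | k + 1 => (β (j + k)).comp (iterComp r β j k)

/-- `Δ`, together with maps `φ_j : (ℤ₊)^{r_j} → Δ`, is the inductive limit of the
sequence of simplicial monoids `(ℤ₊)^{r_j}` along the connecting maps `β_j`.
A monoid arising in this way is a dimension monoid. -/
structure IsInductiveLimit (r : ℕ → ℕ)
    (β : ∀ j : ℕ, (Fin (r j) → ℕ) →+ (Fin (r (j + 1)) → ℕ))
    (Δ : Type*) [AddCommMonoid Δ] (φ : ∀ j : ℕ, (Fin (r j) → ℕ) →+ Δ) : Prop where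
  comp_eq : ∀ j : ℕ, (φ (j + 1)).comp (β j) = φ j
  covers : ∀ d : Δ, ∃ (j : ℕ) (x : Fin (r j) → ℕ), φ j x = d
  eventually_eq : ∀ (j : ℕ) (x y : Fin (r j) → ℕ), φ j x = φ j y →
    ∃ k : ℕ, iterComp r β j k x = iterComp r β j k y

namespace AlgLE

variable {M : Type*} [AddCommMonoid M] {x y z w : M}

theorem refl (x : M) : AlgLE x x := ⟨0, add_zero x⟩

theorem trans (h : AlgLE x y) (h' : AlgLE y z) : AlgLE x z := by
  obtain ⟨a, rfl⟩ := h
  obtain ⟨b, rfl⟩ := h'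
  exact ⟨a + b, by rw [add_assoc]⟩

theorem add (h : AlgLE x y) (h' : AlgLE z w) : AlgLE (x + z) (y + w) := by
  obtain ⟨a, rfl⟩ := h
  obtain ⟨b, rfl⟩ := h'
  exact ⟨a + b, by rw [add_add_add_comm]⟩

theorem nsmul (h : AlgLE x y) (n : ℕ) : AlgLE (n • x) (n • y) := by
  obtain ⟨a, rfl⟩ := h
  exact ⟨n • a, by rw [nsmul_add]⟩

end AlgLE

namespace Propto

variable {M N : Type*} [AddCommMonoid M] [AddCommMonoid N] {x y z : M}

theorem of_algLE (h : AlgLE x y) : Propto x y := ⟨1, le_rfl, by rwa [one_nsmul]⟩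

theorem refl (x : M) : Propto x x := of_algLE (.refl x)

theorem trans (h : Propto x y) (h' : Propto y z) : Propto x z := by
  obtain ⟨m, hm, h⟩ := h
  obtain ⟨n, hn, h'⟩ := h'
  exact ⟨n * m, Nat.mul_pos hn hm, h.trans (by rw [mul_comm, mul_nsmul']; exact h'.nsmul m)⟩

theorem self_add (x y : M) : Propto x (x + y) := of_algLE ⟨y, rfl⟩

theorem zero (x : M) : Propto 0 x := of_algLE ⟨x, zero_add x⟩

theorem add (h : Propto x z) (h' : Propto y z) : Propto (x + y) z := by
  obtain ⟨m, hm, h⟩ := h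
  obtain ⟨n, hn, h'⟩ := h'
  exact ⟨m + n, by omega, by rw [add_nsmul]; exact AlgLE.add h h'⟩

theorem sum {ι : Type*} {s : Finset ι} {f : ι → M} (h : ∀ i ∈ s, Propto (f i) z) :
    Propto (∑ i ∈ s, f i) z :=
  Finset.sum_induction f (Propto · z) (fun _ _ => add) (zero z) h

theorem nsmul (h : Propto x z) (n : ℕ) : Propto (n • x) z := by
  simpa using sum (s := Finset.range n) fun _ _ => h

theorem self_nsmul (x : M) {n : ℕ} (hn : 1 ≤ n) : Propto x (n • x) := by
  obtain ⟨m, rfl⟩ := Nat.exists_eq_add_of_le hn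
  rw [add_nsmul, one_nsmul]
  exact self_add _ _

theorem map (h : Propto x y) (f : M →+ N) : Propto (f x) (f y) := by
  obtain ⟨n, hn, a, h⟩ := h
  exact ⟨n, hn, f a, by rw [← map_add, h, map_nsmul]⟩

theorem of_mem_sum {ι : Type*} {s : Finset ι} {i : ι} (hi : i ∈ s) (f : ι → M) :
    Propto (f i) (∑ j ∈ s, f j) := by
  classical
  rw [← Finset.add_sum_erase s f hi]
  exact self_add _ _

end Propto

section Simplicial

variable {ι : Type*} [DecidableEq ι]

theorem single_propto {x : ι → ℕ} {i : ι} (h : x i ≠ 0) : Propto (Pi.single i 1) x := by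
  refine .of_algLE ⟨x - Pi.single i 1, add_tsub_cancel_of_le ?_⟩
  intro j
  by_cases hj : j = i
  · subst hj
    simpa using Nat.one_le_iff_ne_zero.mpr h
  · simp [hj]

variable [Fintype ι] {N : Type*} [AddCommMonoid N]

/-- The homomorphism out of a simplicial monoid with prescribed values on the basis. -/
noncomputable def basisHom (v : ι → N) : (ι → ℕ) →+ N :=
  (Fintype.linearCombination ℕ v).toAddMonoidHom

theorem map_eq_sum_single (f : (ι → ℕ) →+ N) (x : ι → ℕ) :
    f x = ∑ i, x i • f (Pi.single i 1) := by
  conv_lhs => rw [pi_eq_sum_univ' x]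
  rw [map_sum]
  refine Finset.sum_congr rfl fun i _ => ?_
  rw [map_nsmul]

theorem map_propto_of_support {f : (ι → ℕ) →+ N} {x : ι → ℕ} {z : N}
    (h : ∀ i, x i ≠ 0 → Propto (f (Pi.single i 1)) z) : Propto (f x) z := by
  rw [map_eq_sum_single]
  refine .sum fun i _ => ?_
  by_cases hi : x i = 0
  · rw [hi, zero_nsmul]
    exact .zero z
  · exact (h i hi).nsmul _

theorem propto_of_support_subset {x y : ι → ℕ} (h : ∀ i, x i ≠ 0 → y i ≠ 0) : Propto x y :=
  map_propto_of_support (f := AddMonoidHom.id _) fun i hi => single_propto (h i hi)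

theorem map_propto_map_of_single {f g : (ι → ℕ) →+ N}
    (h : ∀ i, Propto (f (Pi.single i 1)) (g (Pi.single i 1))) (x : ι → ℕ) :
    Propto (f x) (g x) :=
  map_propto_of_support fun i hi => (h i).trans ((single_propto hi).map g)

end Simplicial

section Refinement

variable {M : Type*} [AddCommMonoid M]

theorem IsRefinement.exists_sum_eq_of_algLE (hR : IsRefinement M) (hC : IsConical M) {ι : Type*} (s : Finset ι)
    (w : ι → M) {x : M} (h : AlgLE x (∑ i ∈ s, w i)) :
    ∃ c : ι → M, ∑ i ∈ s, c i = x ∧ ∀ i ∈ s, AlgLE (c i) (w i) := by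
  classical
  induction s using Finset.induction_on generalizing x with
  | empty =>
    obtain ⟨z, hz⟩ := h
    exact ⟨0, by simp [(hC x z (by simpa using hz)).1], by simp⟩
  | insert a s ha ih =>
    obtain ⟨z, h⟩ := h
    rw [Finset.sum_insert ha] at h
    obtain ⟨p, q, p', q', rfl, rfl, hp, hq⟩ := hR _ _ _ _ h
    obtain ⟨c, hc, hcw⟩ := ih ⟨q', hq.symm⟩
    have hne : ∀ i ∈ s, i ≠ a := fun i hi => ne_of_mem_of_not_mem hi ha
    refine ⟨Function.update c a p, ?_, fun i hi => ?_⟩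
    · rw [Finset.sum_insert ha, Function.update_self, ← hc]
      congr 1
      exact Finset.sum_congr rfl fun i hi => Function.update_of_ne (hne i hi) _ _
    · rcases Finset.mem_insert.mp hi with rfl | hi
      · rw [Function.update_self]
        exact ⟨p', hp.symm⟩
      · rw [Function.update_of_ne (hne i hi)]
        exact hcw i hi

theorem IsRefinement.exists_sum_eq_of_propto (hR : IsRefinement M) (hC : IsConical M)
    {ι : Type*} (s : Finset ι) (w : ι → M) {x : M} (h : Propto x (∑ i ∈ s, w i)) :
    ∃ c : ι → M, ∑ i ∈ s, c i = x ∧ ∀ i ∈ s, Propto (c i) (w i) := by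
  obtain ⟨n, hn, h⟩ := h
  rw [← Finset.sum_nsmul] at h
  obtain ⟨c, hc, hcw⟩ := hR.exists_sum_eq_of_algLE hC s _ h
  exact ⟨c, hc, fun i hi => ⟨n, hn, hcw i hi⟩⟩

end Refinement

section Factorization

variable {M : Type*} [AddCommMonoid M]

/-- `f` factors as `f' ∘ g` up to the equivalence relation generated by `Propto`. -/
def FactorsUpTo {A B : Type*} [AddCommMonoid A] [AddCommMonoid B]
    (f : A →+ M) (f' : B →+ M) (g : A →+ B) : Prop :=
  ∀ x, Propto (f x) (f' (g x)) ∧ Propto (f' (g x)) (f x)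

theorem FactorsUpTo.comp {A B C : Type*} [AddCommMonoid A] [AddCommMonoid B] [AddCommMonoid C]
    {f : A →+ M} {f' : B →+ M} {f'' : C →+ M} {g : A →+ B} {g' : B →+ C}
    (h : FactorsUpTo f f' g) (h' : FactorsUpTo f' f'' g') : FactorsUpTo f f'' (g'.comp g) :=
  fun x => ⟨(h x).1.trans (h' (g x)).1, (h' (g x)).2.trans (h x).2⟩

theorem FactorsUpTo.propto {A B : Type*} [AddCommMonoid A] [AddCommMonoid B]
    {f : A →+ M} {f' : B →+ M} {g : A →+ B} (h : FactorsUpTo f f' g) {x y : A}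
    (hxy : Propto (f x) (f y)) : Propto (f' (g x)) (f' (g y)) :=
  (h x).2.trans (hxy.trans (h y).1)

theorem basisHom_single {ι : Type*} [DecidableEq ι] [Fintype ι] (v : ι → M) (i : ι) :
    basisHom v (Pi.single i 1) = v i := by
  simp [basisHom]

/-- A single relation `f x ∝ f y` can be realized in a larger simplicial monoid. -/
theorem exists_factor_of_propto (hC : IsConical M) (hR : IsRefinement M) {ι : Type} [Fintype ι]
    (f : (ι → ℕ) →+ M) {x y : ι → ℕ} (h : Propto (f x) (f y)) :
    ∃ (κ : Type) (_ : Fintype κ) (f' : (κ → ℕ) →+ M) (g : (ι → ℕ) →+ (κ → ℕ)),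
      FactorsUpTo f f' g ∧ Propto (g x) (g y) := by
  classical
  let A : Finset ι := Finset.univ.filter (y · ≠ 0)
  have hA : ∀ k, k ∈ A ↔ y k ≠ 0 := fun k => by simp [A]
  have hy : Propto (f y) (∑ k ∈ A, f (Pi.single k 1)) :=
    map_propto_of_support fun k hk =>
      Propto.of_mem_sum ((hA k).2 hk) fun k => f (Pi.single k 1)
  have hc : ∀ i, ∃ c : ι → M, (x i ≠ 0 → ∑ k ∈ A, c k = f (Pi.single i 1)) ∧
      ∀ k ∈ A, Propto (c k) (f (Pi.single k 1)) := fun i => by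
    by_cases hi : x i = 0
    · exact ⟨0, fun h => (h hi).elim, fun k _ => .zero _⟩
    · obtain ⟨c, hc, hcA⟩ := hR.exists_sum_eq_of_propto hC A (fun k => f (Pi.single k 1))
        ((((single_propto hi).map f).trans h).trans hy)
      exact ⟨c, fun _ => hc, hcA⟩
  choose c hcx hcA using hc
  let f' : (ι ⊕ ι × ι → ℕ) →+ M :=
    basisHom (Sum.elim (fun i => f (Pi.single i 1)) fun p => c p.1 p.2)
  let e : ι ⊕ ι × ι → (ι ⊕ ι × ι → ℕ) := fun k => Pi.single k 1
  let v : ι → (ι ⊕ ι × ι → ℕ) := fun i =>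
    if y i ≠ 0 then e (.inl i) + ∑ j, e (.inr (j, i))
    else if x i ≠ 0 then ∑ k ∈ A, e (.inr (i, k)) else e (.inl i)
  have hv₁ : ∀ i, y i ≠ 0 → v i = e (.inl i) + ∑ j, e (.inr (j, i)) := fun i hi => if_pos hi
  have hv₂ : ∀ i, y i = 0 → x i ≠ 0 → v i = ∑ k ∈ A, e (.inr (i, k)) := fun i hi hx => by
    simp only [v, if_neg (not_not.2 hi), if_pos hx]
  have hv₃ : ∀ i, y i = 0 → x i = 0 → v i = e (.inl i) := fun i hi hx => by
    simp only [v, if_neg (not_not.2 hi), if_neg (not_not.2 hx)]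
  have hfl : ∀ i, f' (e (.inl i)) = f (Pi.single i 1) := fun i => basisHom_single _ _
  have hfr : ∀ i k, f' (e (.inr (i, k))) = c i k := fun i k => basisHom_single _ _
  have hg : ∀ i, basisHom v (Pi.single i 1) = v i := basisHom_single v
  have hf : ∀ i, Propto (f (Pi.single i 1)) (f' (v i)) ∧
      Propto (f' (v i)) (f (Pi.single i 1)) := fun i => by
    by_cases hi : y i = 0
    · have : f' (v i) = f (Pi.single i 1) := by
        by_cases hx : x i = 0
        · rw [hv₃ i hi hx, hfl]
        · rw [hv₂ i hi hx, map_sum, ← hcx i hx]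
          exact Finset.sum_congr rfl fun k _ => hfr i k
      rw [this]
      exact ⟨.refl _, .refl _⟩
    · rw [hv₁ i hi, map_add, hfl, map_sum]
      refine ⟨.self_add _ _, .add (.refl _) (.sum fun j _ => ?_)⟩
      rw [hfr]
      exact hcA j i ((hA i).2 hi)
  refine ⟨_, inferInstance, f', basisHom v, fun z => ⟨?_, ?_⟩, ?_⟩
  · refine map_propto_map_of_single (g := f'.comp (basisHom v)) (fun i => ?_) z
    rw [AddMonoidHom.comp_apply, hg]
    exact (hf i).1
  · refine map_propto_map_of_single (f := f'.comp (basisHom v)) (fun i => ?_) z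
    rw [AddMonoidHom.comp_apply, hg]
    exact (hf i).2
  · have hvy : ∀ k, y k ≠ 0 → Propto (v k) (basisHom v y) := fun k hk => by
      rw [← hg k]
      exact (single_propto hk).map _
    refine map_propto_of_support fun i hx => ?_
    rw [hg]
    by_cases hi : y i = 0
    · rw [hv₂ i hi hx]
      refine .sum fun k hk => .trans ?_ (hvy k ((hA k).1 hk))
      rw [hv₁ k ((hA k).1 hk), add_comm]
      exact (Propto.of_mem_sum (Finset.mem_univ i) fun j => e (.inr (j, k))).trans (.self_add _ _)
    · exact hvy i hi

/-- Finitely many relations can be realized simultaneously in a larger simplicial monoid. -/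
theorem exists_factor_of_finset (hC : IsConical M) (hR : IsRefinement M) {ι : Type} [Fintype ι]
    (f : (ι → ℕ) →+ M) (P : Finset ((ι → ℕ) × (ι → ℕ))) :
    ∃ (κ : Type) (_ : Fintype κ) (f' : (κ → ℕ) →+ M) (g : (ι → ℕ) →+ (κ → ℕ)),
      FactorsUpTo f f' g ∧ ∀ p ∈ P, Propto (f p.1) (f p.2) → Propto (g p.1) (g p.2) := by
  classical
  induction P using Finset.induction_on with
  | empty =>
    exact ⟨ι, ‹_›, f, AddMonoidHom.id _, fun x => ⟨.refl _, .refl _⟩, by simp⟩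
  | insert p P hp ih =>
    obtain ⟨κ, _, f', g, hfg, hP⟩ := ih
    by_cases h : Propto (f p.1) (f p.2)
    · obtain ⟨τ, hτ, f'', g', hfg', hp'⟩ := exists_factor_of_propto hC hR f' (hfg.propto h)
      refine ⟨τ, hτ, f'', g'.comp g, hfg.comp hfg', fun q hq hfq => ?_⟩
      rcases Finset.mem_insert.mp hq with rfl | hq
      · exact hp'
      · exact (hP q hq hfq).map g'
    · refine ⟨κ, ‹_›, f', g, hfg, fun q hq hfq => ?_⟩
      rcases Finset.mem_insert.mp hq with rfl | hq
      · exact (h hfq).elim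
      · exact hP q hq hfq

/-- All relations can be realized simultaneously in a larger simplicial monoid. -/
theorem exists_factor_reflecting (hC : IsConical M) (hR : IsRefinement M) {ι : Type} [Fintype ι]
    (f : (ι → ℕ) →+ M) :
    ∃ (κ : Type) (_ : Fintype κ) (f' : (κ → ℕ) →+ M) (g : (ι → ℕ) →+ (κ → ℕ)),
      FactorsUpTo f f' g ∧ ∀ x y, Propto (f x) (f y) → Propto (g x) (g y) := by
  classical
  let ind : Finset ι → ι → ℕ := fun s i => if i ∈ s then 1 else 0
  have hind : ∀ x : ι → ℕ, ∃ s, Propto x (ind s) ∧ Propto (ind s) x := fun x =>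
    ⟨Finset.univ.filter (x · ≠ 0), propto_of_support_subset (by simp [ind]),
      propto_of_support_subset (by simp [ind])⟩
  obtain ⟨κ, hκ, f', g, hfg, hP⟩ := exists_factor_of_finset hC hR f
    (Finset.univ.image fun s : Finset ι × Finset ι => (ind s.1, ind s.2))
  refine ⟨κ, hκ, f', g, hfg, fun x y h => ?_⟩
  obtain ⟨s, hxs, hsx⟩ := hind x
  obtain ⟨t, hyt, hty⟩ := hind y
  have hst := hP (ind s, ind t) (Finset.mem_image_of_mem _ (Finset.mem_univ (s, t)))
    (((hsx.map f).trans h).trans (hyt.map f))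
  exact ((hxs.map g).trans hst).trans (hty.map g)

/-- A given element can be adjoined to the range, up to the equivalence generated by `Propto`. -/
theorem exists_factor_range {ι : Type} [Fintype ι] (f : (ι → ℕ) →+ M) (m : M) :
    ∃ (κ : Type) (_ : Fintype κ) (f' : (κ → ℕ) →+ M) (g : (ι → ℕ) →+ (κ → ℕ)),
      FactorsUpTo f f' g ∧ ∃ z, f' z = m := by
  classical
  let f' : (Option ι → ℕ) →+ M := basisHom fun k => k.elim m fun i => f (Pi.single i 1)
  let g : (ι → ℕ) →+ (Option ι → ℕ) := basisHom fun i => Pi.single (some i) 1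
  have hfg : ∀ i, f' (g (Pi.single i 1)) = f (Pi.single i 1) := fun i => by
    simp only [f', g, basisHom_single, Option.elim_some]
  refine ⟨_, inferInstance, f', g, fun x => ⟨?_, ?_⟩, Pi.single none 1, basisHom_single _ _⟩
  · refine map_propto_map_of_single (g := f'.comp g) (fun i => ?_) x
    rw [AddMonoidHom.comp_apply, hfg]
    exact .refl _
  · refine map_propto_map_of_single (f := f'.comp g) (fun i => ?_) x
    rw [AddMonoidHom.comp_apply, hfg]
    exact .refl _

theorem exists_next_stage (hC : IsConical M) (hR : IsRefinement M) {n : ℕ}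
    (f : (Fin n → ℕ) →+ M) (m : M) :
    ∃ (k : ℕ) (f' : (Fin k → ℕ) →+ M) (g : (Fin n → ℕ) →+ (Fin k → ℕ)),
      FactorsUpTo f f' g ∧ (∀ x y, Propto (f x) (f y) → Propto (g x) (g y)) ∧
        ∃ z, Propto (f' z) m ∧ Propto m (f' z) := by
  obtain ⟨κ, _, f₁, g₁, h₁, z, rfl⟩ := exists_factor_range f m
  obtain ⟨τ, _, f₂, g₂, h₂, hg₂⟩ := exists_factor_reflecting hC hR f₁
  let E : (τ → ℕ) ≃+ (Fin (Fintype.card τ) → ℕ) :=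
    (LinearEquiv.funCongrLeft ℕ ℕ (Fintype.equivFin τ).symm).toAddEquiv
  have hE : FactorsUpTo f₂ (f₂.comp E.symm.toAddMonoidHom) E.toAddMonoidHom := fun x => by
    simpa using Propto.refl (f₂ x)
  exact ⟨_, _, _, (h₁.comp h₂).comp hE,
    fun x y h => (hg₂ _ _ (h₁.propto h)).map E.toAddMonoidHom,
    _, ((h₂.comp hE) z).2, ((h₂.comp hE) z).1⟩

end Factorization

section Limit

variable (r : ℕ → ℕ) (β : ∀ j : ℕ, (Fin (r j) → ℕ) →+ (Fin (r (j + 1)) → ℕ))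

/-- The connecting maps of a sequence, indexed by an inequality between the endpoints. -/
def transitionMap (i j : ℕ) (h : i ≤ j) : (Fin (r i) → ℕ) →+ (Fin (r j) → ℕ) :=
  Nat.leRec (motive := fun n _ => (Fin (r i) → ℕ) →+ (Fin (r n) → ℕ))
    (AddMonoidHom.id _) (fun {k} _ g => (β k).comp g) h

theorem transitionMap_self (i : ℕ) : transitionMap r β i i le_rfl = AddMonoidHom.id _ :=
  Nat.leRec_self ..

theorem transitionMap_succ (i j : ℕ) (h : i ≤ j) :
    transitionMap r β i (j + 1) (h.trans j.le_succ) = (β j).comp (transitionMap r β i j h) :=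
  Nat.leRec_succ ..

instance transitionMap_directedSystem :
    DirectedSystem (fun j => Fin (r j) → ℕ) (transitionMap r β · · ·) where
  map_self i x := by rw [transitionMap_self, AddMonoidHom.id_apply]
  map_map k j i hij hjk x := by
    induction hjk with
    | refl => rw [transitionMap_self, AddMonoidHom.id_apply]
    | step hjk ih =>
      rw [transitionMap_succ _ _ _ _ hjk, transitionMap_succ _ _ _ _ (hij.trans hjk)]
      exact congrArg _ ih

theorem iterComp_eq_transitionMap (j k : ℕ) :
    iterComp r β j k = transitionMap r β j (j + k) (Nat.le_add_right j k) := by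
  induction k with
  | zero => exact (transitionMap_self r β j).symm
  | succ k ih => exact (congrArg (β (j + k)).comp ih).trans (transitionMap_succ ..).symm

theorem exists_isInductiveLimit :
    ∃ (Δ : Type) (_ : AddCommMonoid Δ) (φ : ∀ j : ℕ, (Fin (r j) → ℕ) →+ Δ),
      IsInductiveLimit r β Δ φ := by
  refine ⟨DirectLimit (fun j => Fin (r j) → ℕ) (transitionMap r β), inferInstance,
    fun j =>
      { toFun := fun x => ⟦⟨j, x⟩⟧
        map_zero' := (DirectLimit.zero_def j).symm
        map_add' := fun x y => (DirectLimit.add_def (f := transitionMap r β) j x y).symm }, ?_, ?_, ?_⟩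
  · intro j
    refine AddMonoidHom.ext fun x => ?_
    have h := DirectLimit.mk_apply (f := transitionMap r β) j (j + 1) x j.le_succ
    rwa [transitionMap_succ r β j j le_rfl, transitionMap_self] at h
  · intro d
    obtain ⟨j, x, rfl⟩ := DirectLimit.exists_eq_mk _ d
    exact ⟨j, x, rfl⟩
  · intro j x y h
    obtain ⟨i, hi, _, hxy⟩ := Quotient.eq.mp h
    obtain ⟨k, rfl⟩ := Nat.exists_eq_add_of_le hi
    exact ⟨k, by rw [iterComp_eq_transitionMap]; exact hxy⟩

end Limit

section Ideals

theorem IsOrderIdeal.mem_of_propto {M : Type*} [AddCommMonoid M] {I : Set M}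
    (hI : IsOrderIdeal I) {x y : M} (h : Propto x y) (hy : y ∈ I) : x ∈ I := by
  obtain ⟨n, -, z, h⟩ := h
  have hn : ∀ n : ℕ, n • y ∈ I := fun n => by
    induction n with
    | zero => rw [zero_nsmul]; exact hI.1
    | succ n ih => rw [succ_nsmul]; exact (hI.2 _ _).2 ⟨ih, hy⟩
  exact ((hI.2 x z).1 (h ▸ hn n)).1

/-- An additive relation, total on both sides, that preserves and reflects `Propto`. -/
structure ProptoCorrespondence {A B : Type*} [AddCommMonoid A] [AddCommMonoid B]
    (R : A → B → Prop) : Prop where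
  zero : R 0 0
  add : ∀ {a b a' b'}, R a b → R a' b' → R (a + a') (b + b')
  left_total : ∀ a, ∃ b, R a b
  right_total : ∀ b, ∃ a, R a b
  propto_iff : ∀ {a b a' b'}, R a b → R a' b' → (Propto a a' ↔ Propto b b')

namespace ProptoCorrespondence

variable {A B : Type*} [AddCommMonoid A] [AddCommMonoid B] {R : A → B → Prop}

theorem flip (h : ProptoCorrespondence R) : ProptoCorrespondence fun b a => R a b :=
  ⟨h.zero, h.add, h.right_total, h.left_total, fun hab hab' => (h.propto_iff hab hab').symm⟩

theorem isOrderIdeal_image (h : ProptoCorrespondence R) {I : Set A} (hI : IsOrderIdeal I) :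
    IsOrderIdeal {b | ∃ a ∈ I, R a b} := by
  refine ⟨⟨0, hI.1, h.zero⟩, fun x y => ⟨?_, ?_⟩⟩
  · rintro ⟨a, ha, hab⟩
    obtain ⟨a₁, h₁⟩ := h.right_total x
    obtain ⟨a₂, h₂⟩ := h.right_total y
    exact ⟨⟨a₁, hI.mem_of_propto ((h.propto_iff h₁ hab).2 (.self_add x y)) ha, h₁⟩,
      ⟨a₂, hI.mem_of_propto ((h.propto_iff h₂ hab).2 (add_comm y x ▸ .self_add y x)) ha, h₂⟩⟩
  · rintro ⟨⟨a₁, ha₁, h₁⟩, ⟨a₂, ha₂, h₂⟩⟩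
    exact ⟨a₁ + a₂, (hI.2 _ _).2 ⟨ha₁, ha₂⟩, h.add h₁ h₂⟩

theorem image_image (h : ProptoCorrespondence R) {I : Set A} (hI : IsOrderIdeal I) :
    {a | ∃ b ∈ {b | ∃ a ∈ I, R a b}, R a b} = I := by
  ext a
  constructor
  · rintro ⟨b, ⟨a', ha', h'⟩, hab⟩
    exact hI.mem_of_propto ((h.propto_iff hab h').2 (.refl b)) ha'
  · intro ha
    obtain ⟨b, hb⟩ := h.left_total a
    exact ⟨b, ⟨a, ha, hb⟩, hb⟩

theorem exists_equiv (h : ProptoCorrespondence R) :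
    ∃ F : {I : Set A // IsOrderIdeal I} ≃ {J : Set B // IsOrderIdeal J},
      ∀ I₁ I₂ : {I : Set A // IsOrderIdeal I},
        (I₁ : Set A) ⊆ (I₂ : Set A) ↔ (F I₁ : Set B) ⊆ (F I₂ : Set B) := by
  refine ⟨⟨fun I => ⟨_, h.isOrderIdeal_image I.2⟩, fun J => ⟨_, h.flip.isOrderIdeal_image J.2⟩,
    fun I => Subtype.ext (h.image_image I.2), fun J => Subtype.ext (h.flip.image_image J.2)⟩,
    fun I₁ I₂ => ⟨?_, fun hI => ?_⟩⟩
  · rintro hI b ⟨a, ha, hab⟩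
    exact ⟨a, hI ha, hab⟩
  · rw [← h.image_image I₁.2, ← h.image_image I₂.2]
    rintro a ⟨b, hb, hab⟩
    exact ⟨b, hI hb, hab⟩

end ProptoCorrespondence

end Ideals

section Correspondence

variable {M : Type*} [AddCommMonoid M] {r : ℕ → ℕ}
  {β : ∀ j : ℕ, (Fin (r j) → ℕ) →+ (Fin (r (j + 1)) → ℕ)}
  {f : ∀ j : ℕ, (Fin (r j) → ℕ) →+ M}

theorem factorsUpTo_iterComp (hf : ∀ j, FactorsUpTo (f j) (f (j + 1)) (β j)) (j k : ℕ) :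
    FactorsUpTo (f j) (f (j + k)) (iterComp r β j k) := by
  induction k with
  | zero => exact fun x => ⟨.refl _, .refl _⟩
  | succ k ih => exact ih.comp (hf (j + k))

variable {Δ : Type*} [AddCommMonoid Δ] {φ : ∀ j : ℕ, (Fin (r j) → ℕ) →+ Δ}

/-- An element of the inductive limit and an element of `M` have a common representative. -/
def LimitRel (f : ∀ j : ℕ, (Fin (r j) → ℕ) →+ M) (φ : ∀ j : ℕ, (Fin (r j) → ℕ) →+ Δ)
    (d : Δ) (m : M) : Prop :=
  ∃ j x, φ j x = d ∧ Propto (f j x) m ∧ Propto m (f j x)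

theorem LimitRel.exists_rep (hφ : IsInductiveLimit r β Δ φ)
    (hf : ∀ j, FactorsUpTo (f j) (f (j + 1)) (β j)) {d : Δ} {m : M} (h : LimitRel f φ d m) :
    ∃ j, ∀ n, j ≤ n → ∃ x, φ n x = d ∧ Propto (f n x) m ∧ Propto m (f n x) := by
  obtain ⟨j, x, hx⟩ := h
  refine ⟨j, fun n hn => ?_⟩
  induction n, hn using Nat.le_induction with
  | base => exact ⟨x, hx⟩
  | succ n _ ih =>
    obtain ⟨y, rfl, h₁, h₂⟩ := ih
    exact ⟨β n y, DFunLike.congr_fun (hφ.comp_eq n) y, (hf n y).2.trans h₁, h₂.trans (hf n y).1⟩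

theorem LimitRel.exists_common_rep (hφ : IsInductiveLimit r β Δ φ)
    (hf : ∀ j, FactorsUpTo (f j) (f (j + 1)) (β j)) {d d' : Δ} {m m' : M}
    (h : LimitRel f φ d m) (h' : LimitRel f φ d' m') :
    ∃ j x x', (φ j x = d ∧ Propto (f j x) m ∧ Propto m (f j x)) ∧
      (φ j x' = d' ∧ Propto (f j x') m' ∧ Propto m' (f j x')) := by
  obtain ⟨j, hj⟩ := h.exists_rep hφ hf
  obtain ⟨j', hj'⟩ := h'.exists_rep hφ hf
  obtain ⟨x, hx⟩ := hj _ (le_max_left j j')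
  obtain ⟨x', hx'⟩ := hj' _ (le_max_right j j')
  exact ⟨_, x, x', hx, hx'⟩

theorem LimitRel.propto_of_eq (hφ : IsInductiveLimit r β Δ φ)
    (hf : ∀ j, FactorsUpTo (f j) (f (j + 1)) (β j)) {d : Δ} {m m' : M}
    (h : LimitRel f φ d m) (h' : LimitRel f φ d m') : Propto m m' := by
  obtain ⟨j, x, x', ⟨hx, -, hm⟩, ⟨hx', hm', -⟩⟩ := h.exists_common_rep hφ hf h'
  obtain ⟨k, hk⟩ := hφ.eventually_eq j x x' (hx.trans hx'.symm)
  have h₁ := (factorsUpTo_iterComp hf j k x).1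
  have h₂ := (factorsUpTo_iterComp hf j k x').2
  rw [hk] at h₁
  exact hm.trans (h₁.trans (h₂.trans hm'))

theorem proptoCorrespondence_limitRel (hφ : IsInductiveLimit r β Δ φ)
    (hf : ∀ j, FactorsUpTo (f j) (f (j + 1)) (β j))
    (hβ : ∀ j x y, Propto (f j x) (f j y) → Propto (β j x) (β j y))
    (hsurj : ∀ m, ∃ j z, Propto (f j z) m ∧ Propto m (f j z)) :
    ProptoCorrespondence (LimitRel f φ) where
  zero := ⟨0, 0, map_zero _, by rw [map_zero]; exact ⟨.refl _, .refl _⟩⟩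
  add := by
    intro a b a' b' h h'
    obtain ⟨j, x, x', ⟨rfl, h₁, h₂⟩, ⟨rfl, h₁', h₂'⟩⟩ := h.exists_common_rep hφ hf h'
    refine ⟨j, x + x', map_add _ _ _, ?_⟩
    rw [map_add]
    exact ⟨.add (h₁.trans (.self_add _ _)) (h₁'.trans (add_comm b' b ▸ .self_add _ _)),
      .add (h₂.trans (.self_add _ _)) (h₂'.trans (add_comm (f j x') _ ▸ .self_add _ _))⟩
  left_total a := by
    obtain ⟨j, x, rfl⟩ := hφ.covers a
    exact ⟨f j x, j, x, rfl, .refl _, .refl _⟩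
  right_total b := by
    obtain ⟨j, z, hz⟩ := hsurj b
    exact ⟨φ j z, j, z, rfl, hz⟩
  propto_iff := by
    intro a b a' b' h h'
    constructor
    · rintro ⟨n, hn, c, hc⟩
      obtain ⟨i, w, rfl⟩ := hφ.covers c
      have hw : LimitRel f φ (φ i w) (f i w) := ⟨i, w, rfl, .refl _, .refl _⟩
      obtain ⟨j, x, y, ⟨rfl, h₁, h₂⟩, ⟨hy, h₃, h₄⟩⟩ := h.exists_common_rep hφ hf hw
      have hl : LimitRel f φ (φ j x + φ i w) (f j x + f j y) :=
        ⟨j, x + y, by rw [map_add, hy], by rw [map_add]; exact ⟨.refl _, .refl _⟩⟩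
      have hr : LimitRel f φ (n • a') (n • b') := by
        obtain ⟨l, x', rfl, h₁', h₂'⟩ := h'
        refine ⟨l, n • x', map_nsmul _ _ _, ?_⟩
        rw [map_nsmul]
        exact ⟨.nsmul (h₁'.trans (.self_nsmul _ hn)) n, .nsmul (h₂'.trans (.self_nsmul _ hn)) n⟩
      rw [hc] at hl
      exact (h₂.trans (.self_add _ _)).trans
        ((LimitRel.propto_of_eq hφ hf hl hr).trans (.nsmul (.refl _) n))
    · intro hb
      obtain ⟨j, x, x', ⟨rfl, h₁, h₂⟩, ⟨rfl, h₁', h₂'⟩⟩ := h.exists_common_rep hφ hf h'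
      have := (hβ j x x' (h₁.trans (hb.trans h₂'))).map (φ (j + 1))
      rwa [← hφ.comp_eq j]

end Correspondence

theorem stmt_10 {M : Type*} [AddCommMonoid M] [Countable M]
    (hC : IsConical M) (hR : IsRefinement M) :
    ∃ (r : ℕ → ℕ) (β : ∀ j : ℕ, (Fin (r j) → ℕ) →+ (Fin (r (j + 1)) → ℕ))
      (Δ : Type) (_ : AddCommMonoid Δ),
      ∃ (φ : ∀ j : ℕ, (Fin (r j) → ℕ) →+ Δ),
        IsInductiveLimit r β Δ φ ∧
        ∃ F : {I : Set Δ // IsOrderIdeal I} ≃ {J : Set M // IsOrderIdeal J},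
          ∀ I₁ I₂ : {I : Set Δ // IsOrderIdeal I},
            (I₁ : Set Δ) ⊆ (I₂ : Set Δ) ↔ (F I₁ : Set M) ⊆ (F I₂ : Set M) := by
  obtain ⟨e, he⟩ := exists_surjective_nat M
  choose k f' g hfg hg hz using fun (s : Σ n, (Fin n → ℕ) →+ M) (m : M) =>
    exists_next_stage hC hR s.2 m
  let stage : ℕ → Σ n, (Fin n → ℕ) →+ M := fun j =>
    Nat.rec ⟨0, 0⟩ (fun j s => ⟨k s (e j), f' s (e j)⟩) j
  obtain ⟨Δ, hΔ, φ, hφ⟩ := exists_isInductiveLimit (fun j => (stage j).1)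
    fun j => g (stage j) (e j)
  refine ⟨_, _, Δ, hΔ, φ, hφ, ?_⟩
  refine (proptoCorrespondence_limitRel (f := fun j => (stage j).2) hφ
    (fun j => hfg (stage j) (e j)) (fun j => hg (stage j) (e j)) fun m => ?_).exists_equiv
  obtain ⟨j, rfl⟩ := he m
  exact ⟨j + 1, hz (stage j) (e j)⟩
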